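/- Power-law model, impossibility for threshold tests: assume F̄(t) > 0 for all t and F̄(t) = C t^{−a}(log t)^{b}(1 + o(1)) as t → ∞, for constants C > 0, a > 0, b ∈ ℝ. Let 1/2 < β < 1, ε_n ∈ (0,1/2] with n^β ε_n → 1, and μ_n → ∞ with (a+1)log μ_n ∼ r log n for a fixed r satisfying 0 ≤ r < (1 + 1/a)(2β − 1). Then for every sequence of thresholds (t_n) ⊂ ℝ, n ε_n² F̄(t_n − μ_n)²/F̄(t_n) → 0 as n → ∞; consequently every sequence of threshold tests is asymptotically powerless. -/

import Mathlib

open Filter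

lemma tail_bounds_aux (F : ℝ → ℝ) (C a b : ℝ) (hC : 0 < C)
    (htail : Tendsto (fun t : ℝ => (1 - F t) / (C * t ^ (-a) * Real.log t ^ b))
      atTop (nhds 1)) (η : ℝ) (hη : 0 < η) :
    ∀ᶠ t : ℝ in atTop, t ^ (-(a + η)) ≤ 1 - F t ∧ 1 - F t ≤ t ^ (-(a - η)) := by
  have h1 := (isLittleO_log_rpow_rpow_atTop b hη).bound (show 0 < 1 / (2 * C) by positivity)
  have h2 := (isLittleO_log_rpow_rpow_atTop (-b) hη).bound (show 0 < C / 2 by positivity)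
  have h3 := htail.eventually (Ioo_mem_nhds (show (1/2 : ℝ) < 1 by norm_num)
    (show (1 : ℝ) < 2 by norm_num))
  filter_upwards [h1, h2, h3, eventually_gt_atTop (Real.exp 1)] with t h1 h2 h3 ht
  have ht0 : 0 < t := (Real.exp_pos 1).trans ht
  have hl : 0 < Real.log t := by
    have := (Real.lt_log_iff_exp_lt ht0).2 ht
    linarith
  have hL : 0 < Real.log t ^ b := Real.rpow_pos_of_pos hl b
  have hT : 0 < t ^ η := Real.rpow_pos_of_pos ht0 η
  have hA : 0 < t ^ (-a) := Real.rpow_pos_of_pos ht0 _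
  rw [Real.rpow_neg hl.le] at h2
  rw [Real.norm_of_nonneg hL.le, Real.norm_of_nonneg hT.le] at h1
  rw [Real.norm_of_nonneg (inv_pos.2 hL).le, Real.norm_of_nonneg hT.le] at h2
  have hD : 0 < C * t ^ (-a) * Real.log t ^ b := by positivity
  obtain ⟨h3, h4⟩ := h3
  rw [lt_div_iff₀ hD] at h3
  rw [div_lt_iff₀ hD] at h4
  constructor
  · rw [show -(a + η) = -a + -η by ring, Real.rpow_add ht0, Real.rpow_neg ht0.le η]
    have h5 : (t ^ η)⁻¹ ≤ C / 2 * Real.log t ^ b := by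
      rw [inv_le_iff_one_le_mul₀ hT]
      rw [inv_le_iff_one_le_mul₀ hL] at h2
      linarith
    have := mul_le_mul_of_nonneg_left h5 hA.le
    linarith
  · rw [show -(a - η) = -a + η by ring, Real.rpow_add ht0]
    have h5 : 2 * C * Real.log t ^ b ≤ t ^ η := by
      have := mul_le_mul_of_nonneg_left h1 (show 0 ≤ 2 * C by positivity)
      rwa [← mul_assoc, mul_one_div_cancel (by positivity), one_mul] at this
    have := mul_le_mul_of_nonneg_left h5 hA.le
    linarith

lemma ratio_bound_aux (F : ℝ → ℝ) (hFmono : Monotone F) (hF0 : ∀ t, 0 ≤ F t)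
    (hFbar : ∀ t, 0 < 1 - F t) (a η M : ℝ) (ha : 0 < a) (hη : 0 < η) (hηa : 3 * η ≤ a)
    (hM : 1 ≤ M)
    (hb : ∀ t, M ≤ t → t ^ (-(a + η)) ≤ 1 - F t ∧ 1 - F t ≤ t ^ (-(a - η)))
    (m t : ℝ) (hm : M ≤ m) :
    (1 - F (t - m)) ^ 2 / (1 - F t) ≤ (2 * m) ^ (a + η) := by
  have hm1 : 1 ≤ m := hM.trans hm
  rw [div_le_iff₀ (hFbar t)]
  rcases le_or_gt t (2 * m) with h | h
  · have h1 := (hb (2 * m) (by linarith)).1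
    have h2 : 1 - F (2 * m) ≤ 1 - F t := by linarith [hFmono h]
    have h3 : (1 - F (t - m)) ^ 2 ≤ 1 := by
      have := hF0 (t - m)
      have := hFbar (t - m)
      nlinarith
    have hp : 0 < (2 * m) ^ (a + η) := Real.rpow_pos_of_pos (by linarith) _
    rw [Real.rpow_neg (by linarith), inv_le_iff_one_le_mul₀ hp] at h1
    have := mul_le_mul_of_nonneg_right h2 hp.le
    linarith
  · have hu : m < t / 2 := by linarith
    have hu0 : 0 < t / 2 := by linarith
    have h1 := (hb t (by linarith)).1
    have h2 := (hb (t / 2) (by linarith)).2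
    have h3 : 1 - F (t - m) ≤ 1 - F (t / 2) := by
      linarith [hFmono (show t / 2 ≤ t - m by linarith)]
    have h4 : (1 - F (t - m)) ^ 2 ≤ ((t / 2) ^ (-(a - η))) ^ 2 :=
      pow_le_pow_left₀ (hFbar _).le (h3.trans h2) 2
    have h5 : ((t / 2) ^ (-(a - η))) ^ 2 ≤ (t / 2) ^ (-(a + η)) := by
      rw [← Real.rpow_natCast, ← Real.rpow_mul hu0.le]
      apply Real.rpow_le_rpow_of_exponent_le (by linarith)
      push_cast
      linarith
    have h6 : (t / 2) ^ (-(a + η)) = 2 ^ (a + η) * t ^ (-(a + η)) := by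
      rw [Real.div_rpow (by linarith) (by norm_num), Real.rpow_neg (by norm_num : (0:ℝ) ≤ 2)]
      rw [div_inv_eq_mul, mul_comm]
    have h7 : (2 : ℝ) ^ (a + η) ≤ (2 * m) ^ (a + η) :=
      Real.rpow_le_rpow (by norm_num) (by linarith) (by linarith)
    calc _ ≤ 2 ^ (a + η) * t ^ (-(a + η)) := by linarith
      _ ≤ (2 * m) ^ (a + η) * (1 - F t) :=
        mul_le_mul h7 h1 (Real.rpow_nonneg (by linarith) _) (Real.rpow_nonneg (by linarith) _)

/-- In the power-law model `F̄(t) = C t^{-a} (log t)^b (1 + o(1))`, below the boundary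
`r = (1 + 1/a)(2β - 1)` every sequence of threshold tests is asymptotically powerless:
for any thresholds `(t_n)`, `n ε_n² F̄(t_n - μ_n)² / F̄(t_n) → 0`. -/
theorem threshold_tests_powerless_power_law
    (F : ℝ → ℝ) (hFcont : Continuous F) (hFmono : Monotone F)
    (hFbot : Tendsto F atBot (nhds 0)) (hFtop : Tendsto F atTop (nhds 1))
    (hFbar : ∀ t, 0 < 1 - F t)
    (C a b : ℝ) (hC : 0 < C) (ha : 0 < a)
    (htail : Tendsto (fun t : ℝ => (1 - F t) / (C * t ^ (-a) * Real.log t ^ b))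
      atTop (nhds 1))
    (β r : ℝ) (hβ : β ∈ Set.Ioo (1 / 2 : ℝ) 1)
    (hr0 : 0 ≤ r) (hr : r < (1 + 1 / a) * (2 * β - 1))
    (ε : ℕ → ℝ) (hε : ∀ n, ε n ∈ Set.Ioc (0 : ℝ) (1 / 2))
    (hεβ : Tendsto (fun n : ℕ => (n : ℝ) ^ β * ε n) atTop (nhds 1))
    (μ : ℕ → ℝ) (hμtop : Tendsto μ atTop atTop)
    (hμr : Tendsto (fun n : ℕ => (a + 1) * Real.log (μ n) / (r * Real.log n))
      atTop (nhds 1)) :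
    ∀ t : ℕ → ℝ,
      Tendsto (fun n : ℕ => n * ε n ^ 2 * (1 - F (t n - μ n)) ^ 2 / (1 - F (t n)))
        atTop (nhds 0) := by
  intro t
  have hF0 : ∀ t, 0 ≤ F t := fun t => hFmono.le_of_tendsto hFbot t
  have hrpos : 0 < r := by
    rcases hr0.eq_or_lt with h | h
    · subst h
      simp only [zero_mul, div_zero] at hμr
      exact absurd (tendsto_nhds_unique hμr tendsto_const_nhds) (by norm_num)
    · exact h
  -- choice of η
  have hη : ∃ η : ℝ, 0 < η ∧ 3 * η ≤ a ∧ 1 - 2 * β + (a + η) * ((1 + η) * r / (a + 1)) < 0 := by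
    have hc : Tendsto (fun η : ℝ => 1 - 2 * β + (a + η) * ((1 + η) * r / (a + 1))) (nhds 0)
        (nhds (1 - 2 * β + (a + 0) * ((1 + 0) * r / (a + 1)))) :=
      Continuous.tendsto (f := fun η : ℝ => 1 - 2 * β + (a + η) * ((1 + η) * r / (a + 1)))
        (by fun_prop) 0
    have hneg : 1 - 2 * β + (a + 0) * ((1 + 0) * r / (a + 1)) < 0 := by
      have h1 : r * a < (a + 1) * (2 * β - 1) := by
        have := mul_lt_mul_of_pos_right hr ha
        have h2 : (1 + 1 / a) * (2 * β - 1) * a = (a + 1) * (2 * β - 1) := by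
          field_simp
        linarith
      have h3 : (a + 0) * ((1 + 0) * r / (a + 1)) = r * a / (a + 1) := by ring
      have h4 : r * a / (a + 1) < 2 * β - 1 := by
        rw [div_lt_iff₀ (by linarith)]; linarith
      linarith
    have e1 := (hc.eventually (gt_mem_nhds hneg)).filter_mono
      (nhdsWithin_le_nhds (s := Set.Ioi (0 : ℝ)))
    have e2 : ∀ᶠ η : ℝ in nhdsWithin 0 (Set.Ioi 0), η ∈ Set.Ioo (0 : ℝ) (a / 3) :=
      Ioo_mem_nhdsGT (by positivity)
    obtain ⟨η, h1, h2⟩ := (e1.and e2).exists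
    exact ⟨η, h2.1, by linarith [h2.2], h1⟩
  obtain ⟨η, hη, hηa, hneg⟩ := hη
  set κ := 1 - 2 * β + (a + η) * ((1 + η) * r / (a + 1)) with hκ
  obtain ⟨M0, hM0⟩ := eventually_atTop.1 (tail_bounds_aux F C a b hC htail η hη)
  have hlim : Tendsto (fun n : ℕ => 4 * 2 ^ (a + η) * (n : ℝ) ^ κ) atTop (nhds 0) := by
    have h1 : Tendsto (fun x : ℝ => x ^ (-(-κ))) atTop (nhds 0) :=
      tendsto_rpow_neg_atTop (by linarith)
    have h2 := (h1.comp tendsto_natCast_atTop_atTop).const_mul (4 * (2 : ℝ) ^ (a + η))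
    simpa using h2
  have e1 := hεβ.eventually (gt_mem_nhds (show (1 : ℝ) < 2 by norm_num))
  have e2 := hμr.eventually (gt_mem_nhds (show (1 : ℝ) < 1 + η by linarith))
  refine tendsto_of_tendsto_of_tendsto_of_le_of_le' tendsto_const_nhds hlim ?_ ?_
  · filter_upwards with n
    have := hFbar (t n)
    positivity
  · filter_upwards [e1, e2, hμtop.eventually_ge_atTop (max 1 M0), eventually_gt_atTop 1]
      with n h1 h2 h3 hn
    have hn1 : (1 : ℝ) < n := by exact_mod_cast hn
    have hn0 : (0 : ℝ) < n := by linarith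
    have hlog : 0 < Real.log n := Real.log_pos hn1
    have hμ1 : 1 ≤ μ n := (le_max_left _ _).trans h3
    have hμ0 : 0 < μ n := by linarith
    have hR := ratio_bound_aux F hFmono hF0 hFbar a η (max 1 M0) ha hη hηa (le_max_left _ _)
      (fun t ht => hM0 t ((le_max_right _ _).trans ht)) (μ n) (t n) h3
    have hμn : μ n ≤ (n : ℝ) ^ ((1 + η) * r / (a + 1)) := by
      rw [div_lt_iff₀ (by positivity)] at h2
      rw [← Real.log_le_log_iff hμ0 (Real.rpow_pos_of_pos hn0 _), Real.log_rpow hn0,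
        div_mul_eq_mul_div, le_div_iff₀ (by linarith)]
      linarith
    have hp : (2 * μ n) ^ (a + η) ≤
        2 ^ (a + η) * (n : ℝ) ^ ((a + η) * ((1 + η) * r / (a + 1))) := by
      rw [Real.mul_rpow (by norm_num) hμ0.le, mul_comm (a + η) (_ / _), Real.rpow_mul hn0.le]
      gcongr
    have hε2 : n * ε n ^ 2 ≤ 4 * (n : ℝ) ^ (1 - 2 * β) := by
      have hB : 0 < (n : ℝ) ^ β := Real.rpow_pos_of_pos hn0 _
      have h5 : ((n : ℝ) ^ β * ε n) ^ 2 ≤ 2 ^ 2 :=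
        pow_le_pow_left₀ (mul_nonneg hB.le (hε n).1.le) h1.le 2
      have h6 : (n : ℝ) ^ (1 - 2 * β) = n / ((n : ℝ) ^ β) ^ 2 := by
        rw [Real.rpow_sub hn0, Real.rpow_one, mul_comm, Real.rpow_mul hn0.le]
        norm_num
      rw [h6, ← mul_div_assoc, le_div_iff₀ (by positivity)]
      nlinarith
    calc n * ε n ^ 2 * (1 - F (t n - μ n)) ^ 2 / (1 - F (t n))
        = (n * ε n ^ 2) * ((1 - F (t n - μ n)) ^ 2 / (1 - F (t n))) := by ring
      _ ≤ (4 * (n : ℝ) ^ (1 - 2 * β)) *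
          (2 ^ (a + η) * (n : ℝ) ^ ((a + η) * ((1 + η) * r / (a + 1)))) :=
        mul_le_mul hε2 (hR.trans hp) (div_nonneg (sq_nonneg _) (hFbar _).le) (by positivity)
      _ = 4 * 2 ^ (a + η) * (n : ℝ) ^ κ := by
        rw [hκ, Real.rpow_add hn0]; ring
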